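/- In the hyperoctahedral group B_n (signed permutations of {1,...,n}), the flag major index is equidistributed with the Coxeter length: for every k ≥ 0, the number of elements π ∈ B_n with flag-major(π) = k equals the number of elements with ℓ(π) = k. -/

import Mathlib

open Finset

@[ext]
structure GenPerm (m n : ℕ) where
  σ : Equiv.Perm (Fin n)
  c : Fin n → ZMod m
deriving DecidableEq

namespace GenPerm

variable {m n : ℕ}

instance [NeZero m] : Fintype (GenPerm m n) :=
  Fintype.ofEquiv (Equiv.Perm (Fin n) × (Fin n → ZMod m))
    { toFun := fun p => ⟨p.1, p.2⟩
      invFun := fun g => (g.σ, g.c)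
      left_inv := fun p => rfl
      right_inv := fun g => rfl }

instance : Mul (GenPerm m n) := ⟨fun g h => ⟨g.σ * h.σ, fun j => g.c (h.σ j) + h.c j⟩⟩
instance : One (GenPerm m n) := ⟨⟨1, 0⟩⟩
instance : Inv (GenPerm m n) := ⟨fun g => ⟨g.σ⁻¹, fun j => - g.c (g.σ⁻¹ j)⟩⟩

@[simp] lemma mul_σ (g h : GenPerm m n) : (g * h).σ = g.σ * h.σ := rfl
@[simp] lemma mul_c (g h : GenPerm m n) (j : Fin n) : (g * h).c j = g.c (h.σ j) + h.c j := rfl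
@[simp] lemma one_σ : (1 : GenPerm m n).σ = 1 := rfl
@[simp] lemma one_c (j : Fin n) : (1 : GenPerm m n).c j = 0 := rfl
@[simp] lemma inv_σ (g : GenPerm m n) : (g⁻¹).σ = g.σ⁻¹ := rfl
@[simp] lemma inv_c (g : GenPerm m n) (j : Fin n) : (g⁻¹).c j = - g.c (g.σ⁻¹ j) := rfl

instance : Group (GenPerm m n) where
  mul_assoc a b c := by
    ext j
    · simp [mul_assoc]
    · simp [add_assoc]
  one_mul a := by
    ext j
    · simp
    · simp
  mul_one a := by
    ext j
    · simp
    · simp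
  inv_mul_cancel a := by
    ext j
    · simp
    · simp

/-- The generator `s i`: `s 0` multiplies the first letter's phase by `ω`;
for `1 ≤ i < n`, `s i` swaps positions `i` and `i+1` (1-indexed), i.e. `i-1` and `i`
(0-indexed). -/
def s (i : ℕ) : GenPerm m n :=
  if h : i < n then
    if h0 : i = 0 then ⟨1, fun j => if j = ⟨0, by omega⟩ then 1 else 0⟩
    else ⟨Equiv.swap ⟨i - 1, by omega⟩ ⟨i, h⟩, 0⟩
  else 1

/-- `t i = s i * s (i-1) * ⋯ * s 1 * s 0`. -/
def t (i : ℕ) : GenPerm m n := ((List.range (i + 1)).map (fun j => (s (i - j) : GenPerm m n))).prod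

/-- `rep k = t (n-1) ^ k (n-1) * ⋯ * t 0 ^ k 0`. -/
def rep (k : Fin n → ℕ) : GenPerm m n :=
  (List.ofFn (fun i : Fin n => (t (i : ℕ) : GenPerm m n) ^ k i)).reverse.prod

open scoped Classical in
/-- The flag major index: the sum of the exponents in the canonical representation
`π = t (n-1) ^ k (n-1) * ⋯ * t 0 ^ k 0` with `0 ≤ k i < m * (i+1)`. -/
noncomputable def flagMajor (π : GenPerm m n) : ℕ :=
  if h : ∃ k : Fin n → ℕ, (∀ i : Fin n, k i < m * ((i : ℕ) + 1)) ∧ π = rep k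
  then ∑ i, h.choose i else 0

/-- The major index of a generalized permutation with respect to the linear order
`1·ω^{m-1} < ⋯ < n·ω^{m-1} < ⋯ < 1·ω < ⋯ < n·ω < 1 < ⋯ < n`
(a 1-indexed descent at position `i` contributes `i`). -/
def majG (π : GenPerm m n) : ℕ :=
  ∑ i ∈ Finset.range n, if h : i + 1 < n then
    (if (π.c ⟨i, by omega⟩).val < (π.c ⟨i + 1, h⟩).val ∨
        (π.c ⟨i, by omega⟩ = π.c ⟨i + 1, h⟩ ∧ π.σ ⟨i + 1, h⟩ < π.σ ⟨i, by omega⟩)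
     then i + 1 else 0) else 0

/-- Coxeter length with respect to the generators `s 0, s 1, …, s (n-1)`. -/
noncomputable def len (π : GenPerm m n) : ℕ :=
  sInf {l | ∃ w : List (Fin n), w.length = l ∧ (w.map (fun i => (s (i : ℕ) : GenPerm m n))).prod = π}

lemma s_val {j : ℕ} (hj : j < n) (p : Fin n) : ((s j : GenPerm m n).σ p : ℕ) =
    if j = 0 then (p : ℕ) else if (p : ℕ) = j - 1 then j else if (p : ℕ) = j then j - 1 else p := by
  unfold s
  rw [dif_pos hj]
  by_cases h0 : j = 0
  · simp [h0]
  · simp only [h0, dite_false, if_false, Equiv.swap_apply_def]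
    simp only [Fin.ext_iff]
    split_ifs <;> rfl

lemma s_c {j : ℕ} (hj : j < n) (p : Fin n) : (s j : GenPerm m n).c p =
    if j = 0 ∧ (p : ℕ) = 0 then 1 else 0 := by
  unfold s
  rw [dif_pos hj]
  by_cases h0 : j = 0
  · simp [h0, Fin.ext_iff]
  · simp [h0]

lemma t_succ (i : ℕ) : (t (i + 1) : GenPerm m n) = s (i + 1) * t i := by
  unfold t
  rw [List.range_succ_eq_map (n := i + 1)]
  simp only [List.map_cons, List.prod_cons, List.map_map, Nat.sub_zero]
  congr 2
  apply List.map_congr_left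
  intro a _
  simp

lemma t_zero : (t 0 : GenPerm m n) = s 0 := by
  simp [t]

lemma t_val {i : ℕ} (hi : i < n) (p : Fin n) : ((t i : GenPerm m n).σ p : ℕ) =
    if (p : ℕ) = 0 then i else if (p : ℕ) ≤ i then p - 1 else p := by
  induction i with
  | zero => rw [t_zero, s_val hi]; grind
  | succ i ih =>
    rw [t_succ, mul_σ, Equiv.Perm.mul_apply, s_val hi, ih (by omega)]
    grind

lemma t_c {i : ℕ} (hi : i < n) (p : Fin n) : (t i : GenPerm m n).c p =
    if (p : ℕ) = 0 then 1 else 0 := by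
  induction i with
  | zero => rw [t_zero, s_c hi]; simp
  | succ i ih =>
    rw [t_succ, mul_c, s_c hi, ih (by omega), if_neg (by omega), zero_add]

lemma tpow_fix {i : ℕ} (hi : i < n) (a : ℕ) (p : Fin n) (hp : i < p) :
    ((t i : GenPerm m n) ^ a).σ p = p ∧ ((t i : GenPerm m n) ^ a).c p = 0 := by
  induction a with
  | zero => simp
  | succ a ih =>
    rw [pow_succ', mul_σ, mul_c, Equiv.Perm.mul_apply, ih.1, ih.2]
    refine ⟨Fin.ext ?_, ?_⟩
    · rw [t_val hi]; grind
    · rw [t_c hi]; grind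

lemma tpow_val {i : ℕ} (hi : i < n) (a : ℕ) (ha : a < 2 * (i + 1)) :
    ((((t i : GenPerm m n) ^ a).σ ⟨i, hi⟩ : Fin n) : ℕ) = (if a ≤ i then i - a else 2 * i + 1 - a) ∧
    ((t i : GenPerm m n) ^ a).c ⟨i, hi⟩ = if a ≤ i then 0 else 1 := by
  induction a with
  | zero => simp
  | succ a ih =>
    obtain ⟨h1, h2⟩ := ih (by omega)
    rw [pow_succ', mul_σ, mul_c, Equiv.Perm.mul_apply, h2, t_val hi, t_c hi, h1]
    constructor
    · split_ifs <;> omega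
    · split_ifs <;> first | omega | simp

/-- Suffixes of `s i ⋯ s 1 s 0 s 1 ⋯ s i`. -/
def r (i : ℕ) : ℕ → GenPerm m n
  | 0 => 1
  | a + 1 => s (if a ≤ i then i - a else a - i) * r i a

lemma r_val {i : ℕ} (hi : i < n) (a : ℕ) (ha : a < 2 * (i + 1)) (p : Fin n) :
    (((r i a : GenPerm m n).σ p : Fin n) : ℕ) =
      if (p : ℕ) = i then (if a ≤ i then i - a else a - i - 1)
      else if (if a ≤ i then i - a else a - i - 1) ≤ (p : ℕ) ∧ (p : ℕ) < i then p + 1 else p := by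
  induction a with
  | zero => simp [r]; grind
  | succ a ih =>
    rw [r, mul_σ, Equiv.Perm.mul_apply, s_val (by split_ifs <;> omega), ih (by omega)]
    split_ifs <;> omega

lemma r_c {i : ℕ} (hi : i < n) (a : ℕ) (ha : a < 2 * (i + 1)) (p : Fin n) :
    (r i a : GenPerm m n).c p = if (p : ℕ) = i ∧ i < a then 1 else 0 := by
  induction a with
  | zero => simp [r]
  | succ a ih =>
    rw [r, mul_c, s_c (by split_ifs <;> omega), ih (by omega), r_val hi a (by omega)]
    split_ifs <;> first | omega | (simp; done) | grind

/-- `g (m-1) * ⋯ * g 0`. -/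
def P {G : Type*} [Monoid G] (g : ℕ → G) : ℕ → G
  | 0 => 1
  | l + 1 => g l * P g l

lemma P_congr {G : Type*} [Monoid G] (g h : ℕ → G) (l : ℕ) (H : ∀ i < l, g i = h i) :
    P g l = P h l := by
  induction l with
  | zero => rfl
  | succ l ih => rw [P, P, H l (by omega), ih (fun i hi => H i (by omega))]

lemma P_ofFn {G : Type*} [Monoid G] (g : ℕ → G) (l : ℕ) :
    (List.ofFn (fun i : Fin l => g i)).reverse.prod = P g l := by
  induction l with
  | zero => simp [P]
  | succ l ih =>
    rw [List.ofFn_succ', List.concat_eq_append, List.reverse_append, List.prod_append, P, ← ih]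
    simp

lemma P_fix (f : ℕ → GenPerm m n) (l : ℕ)
    (H : ∀ i < l, ∀ p : Fin n, i < p → (f i).σ p = p ∧ (f i).c p = 0) (p : Fin n) (hp : l ≤ p) :
    (P f l).σ p = p ∧ (P f l).c p = 0 := by
  induction l with
  | zero => simp [P]
  | succ l ih =>
    obtain ⟨h1, h2⟩ := ih (fun i hi => H i (by omega)) (by omega)
    obtain ⟨h3, h4⟩ := H l (by omega) p (by omega)
    simp [P, h1, h2, h3, h4]

lemma P_inj (f : ℕ → ℕ → GenPerm m n)
    (H : ∀ i < n, ∀ a < 2 * (i + 1), ∀ p : Fin n, i < p → (f i a).σ p = p ∧ (f i a).c p = 0)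
    (H2 : ∀ i, ∀ hi : i < n, ∀ a < 2 * (i + 1), ∀ b < 2 * (i + 1),
      (f i a).σ ⟨i, hi⟩ = (f i b).σ ⟨i, hi⟩ → (f i a).c ⟨i, hi⟩ = (f i b).c ⟨i, hi⟩ → a = b)
    (k k' : ℕ → ℕ) (hk : ∀ i, k i < 2 * (i + 1)) (hk' : ∀ i, k' i < 2 * (i + 1))
    (l : ℕ) (hl : l ≤ n)
    (h : P (fun i => f i (k i)) l = P (fun i => f i (k' i)) l) : ∀ i < l, k i = k' i := by
  induction l with
  | zero => intro i hi; omega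
  | succ l ih =>
    obtain ⟨h1, h2⟩ := P_fix (fun i => f i (k i)) l
      (fun i hi => H i (by omega) _ (hk i)) ⟨l, by omega⟩ le_rfl
    obtain ⟨h1', h2'⟩ := P_fix (fun i => f i (k' i)) l
      (fun i hi => H i (by omega) _ (hk' i)) ⟨l, by omega⟩ le_rfl
    rw [P, P] at h
    have e : k l = k' l := by
      apply H2 l (by omega) _ (hk l) _ (hk' l)
      · have := congrArg (fun g : GenPerm m n => g.σ ⟨l, by omega⟩) h
        simpa [h1, h1'] using this
      · have := congrArg (fun g : GenPerm m n => g.c ⟨l, by omega⟩) h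
        simpa [h1, h1', h2, h2'] using this
    rw [e] at h
    have := ih (by omega) (mul_left_cancel h)
    intro i hi
    rcases Nat.lt_succ_iff_lt_or_eq.mp hi with h | h
    · exact this i h
    · rw [h, e]

/-- Exponent vectors. -/
abbrev K (n : ℕ) := (i : Fin n) → Fin (2 * ((i : ℕ) + 1))

/-- Extension by zero. -/
def ex (k : K n) : ℕ → ℕ := fun i => if h : i < n then k ⟨i, h⟩ else 0

lemma ex_lt (k : K n) (i : ℕ) : ex k i < 2 * (i + 1) := by
  unfold ex
  split_ifs with h
  · exact (k ⟨i, h⟩).2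
  · omega

lemma ex_fin (k : K n) (i : Fin n) : ex k i = k i := by
  simp [ex]

lemma card_eq : Fintype.card (K n) = Fintype.card (GenPerm 2 n) := by
  have : Fintype.card (GenPerm 2 n) = Fintype.card (Equiv.Perm (Fin n) × (Fin n → ZMod 2)) :=
    Fintype.card_congr
    { toFun := fun g => (g.σ, g.c)
      invFun := fun p => ⟨p.1, p.2⟩
      left_inv := fun p => rfl
      right_inv := fun g => rfl }
  rw [this]
  simp only [Fintype.card_pi, Fintype.card_fin, Fintype.card_prod, Fintype.card_perm, ZMod.card,
    Finset.prod_mul_distrib, Finset.prod_const, Finset.card_univ]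
  rw [mul_comm, Fin.prod_univ_eq_prod_range (fun i => i + 1) n, Finset.prod_range_add_one_eq_factorial]

lemma P_bij (f : ℕ → ℕ → GenPerm 2 n)
    (H : ∀ i < n, ∀ a < 2 * (i + 1), ∀ p : Fin n, i < p → (f i a).σ p = p ∧ (f i a).c p = 0)
    (H2 : ∀ i, ∀ hi : i < n, ∀ a < 2 * (i + 1), ∀ b < 2 * (i + 1),
      (f i a).σ ⟨i, hi⟩ = (f i b).σ ⟨i, hi⟩ → (f i a).c ⟨i, hi⟩ = (f i b).c ⟨i, hi⟩ → a = b) :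
    Function.Bijective (fun k : K n => P (fun i => f i (ex k i)) n) := by
  rw [Fintype.bijective_iff_injective_and_card]
  refine ⟨?_, card_eq⟩
  intro k k' h
  have := P_inj f H H2 (ex k) (ex k') (ex_lt k) (ex_lt k') n le_rfl h
  funext i
  have := this i i.2
  rw [ex_fin, ex_fin] at this
  exact Fin.ext this

lemma t_bij : Function.Bijective
    (fun k : K n => P (fun i => (t i : GenPerm 2 n) ^ (ex k i)) n) := by
  apply P_bij (fun i a => (t i : GenPerm 2 n) ^ a)
  · intro i hi a _ p hp
    exact tpow_fix hi a p hp
  · intro i hi a ha b hb h1 h2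
    have h1 := congrArg Fin.val h1
    simp only [(tpow_val hi a ha).1, (tpow_val hi b hb).1] at h1
    simp only [(tpow_val hi a ha).2, (tpow_val hi b hb).2] at h2
    split_ifs at h1 h2 <;> first | omega | simp at h2

lemma r_bij : Function.Bijective
    (fun k : K n => P (fun i => (r i (ex k i) : GenPerm 2 n)) n) := by
  apply P_bij (fun i a => (r i a : GenPerm 2 n))
  · intro i hi a ha p hp
    refine ⟨Fin.ext ?_, ?_⟩
    · rw [r_val hi a ha]; split_ifs <;> omega
    · rw [r_c hi a ha]; split_ifs <;> first | omega | rfl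
  · intro i hi a ha b hb h1 h2
    have h1 := congrArg Fin.val h1
    simp only [r_val hi a ha, r_val hi b hb, if_true] at h1
    simp only [r_c hi a ha, r_c hi b hb, true_and] at h2
    split_ifs at h1 h2 <;> first | omega | simp at h2

lemma flagMajor_P (k : K n) :
    flagMajor (P (fun i => (t i : GenPerm 2 n) ^ (ex k i)) n) = ∑ i, (k i : ℕ) := by
  have key : ∀ k : K n, P (fun i => (t i : GenPerm 2 n) ^ (ex k i)) n = rep (fun i => (k i : ℕ)) := by
    intro k
    rw [← P_ofFn]
    simp only [ex_fin]
    rfl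
  have h : ∃ k' : Fin n → ℕ, (∀ i : Fin n, k' i < 2 * ((i : ℕ) + 1)) ∧
      P (fun i => (t i : GenPerm 2 n) ^ (ex k i)) n = rep k' :=
    ⟨fun i => k i, fun i => (k i).2, key k⟩
  unfold flagMajor
  rw [dif_pos h]
  obtain ⟨hb, he⟩ := h.choose_spec
  have e : (fun i => ⟨h.choose i, hb i⟩ : K n) = k := by
    apply t_bij.1
    change P _ n = P _ n
    rw [key, ← he]
  apply Finset.sum_congr rfl
  intro i _
  exact congrArg Fin.val (congrFun e i)

/-- `g` is a product of `l` generators. -/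
def IsWord (g : GenPerm m n) (l : ℕ) : Prop :=
  ∃ w : List (Fin n), w.length = l ∧ (w.map (fun i : Fin n => (s (i : ℕ) : GenPerm m n))).prod = g

lemma len_eq (g : GenPerm m n) : len g = sInf {l | IsWord g l} := by
  unfold len IsWord
  congr 1
  ext l
  simp only [Set.mem_setOf_eq]
  apply exists_congr
  intro w
  have e : (do let a ← w; pure (a : ℕ) : List ℕ) = w.map (fun a : Fin n => (a : ℕ)) := by
    simp [List.map_eq_flatMap]
  rw [e, List.map_map]
  rfl

lemma IsWord.mul {g h : GenPerm m n} {a b : ℕ} (hg : IsWord g a) (hh : IsWord h b) :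
    IsWord (g * h) (a + b) := by
  obtain ⟨w, rfl, rfl⟩ := hg
  obtain ⟨v, rfl, rfl⟩ := hh
  exact ⟨w ++ v, by simp, by simp⟩

lemma isWord_one : IsWord (1 : GenPerm m n) 0 := ⟨[], rfl, rfl⟩

lemma isWord_s {j : ℕ} (hj : j < n) : IsWord (s j : GenPerm m n) 1 :=
  ⟨[⟨j, hj⟩], rfl, by simp⟩

lemma isWord_r {i : ℕ} (hi : i < n) (a : ℕ) (ha : a < 2 * (i + 1)) :
    IsWord (r i a : GenPerm m n) a := by
  induction a with
  | zero => exact isWord_one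
  | succ a ih =>
    rw [r, add_comm a 1]
    exact (isWord_s (by split_ifs <;> omega)).mul (ih (by omega))

lemma isWord_P (k : ℕ → ℕ) (hk : ∀ i, k i < 2 * (i + 1)) (l : ℕ) (hl : l ≤ n) :
    IsWord (P (fun i => (r i (k i) : GenPerm m n)) l) (∑ i ∈ range l, k i) := by
  induction l with
  | zero => exact isWord_one
  | succ l ih =>
    rw [P, Finset.sum_range_succ, add_comm]
    exact (isWord_r (by omega) _ (hk l)).mul (ih (by omega))

lemma ext_val {g h : GenPerm m n} (h1 : ∀ p, ((g.σ p : Fin n) : ℕ) = h.σ p)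
    (h2 : ∀ p, g.c p = h.c p) : g = h := by
  ext p
  · exact h1 p
  · exact h2 p

set_option maxHeartbeats 1000000 in
/-- Deodhar's lemma for the coset representatives. -/
lemma s_mul_r {i j : ℕ} (hi : i < n) (hj : j ≤ i) (a : ℕ) (ha : a < 2 * (i + 1)) :
    (∃ a' < 2 * (i + 1), a' ≤ a + 1 ∧ (s j * r i a : GenPerm 2 n) = r i a') ∨
    (∃ j' < i, (s j * r i a : GenPerm 2 n) = r i a * s j') := by
  have hjn : j < n := by omega
  obtain ⟨d, hd⟩ : ∃ d, d = if a ≤ i then i - a else a - i - 1 := ⟨_, rfl⟩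
  by_cases c1 : 0 < j ∧ d + 1 = j
  · left
    refine ⟨if a ≤ i then a - 1 else a + 1, ?_, ?_, ?_⟩
    · split_ifs at * <;> omega
    · split_ifs at * <;> omega
    have hb : (if a ≤ i then a - 1 else a + 1) < 2 * (i + 1) := by split_ifs at * <;> omega
    apply ext_val <;> intro p
    · rw [mul_σ, Equiv.Perm.mul_apply, s_val hjn, r_val hi _ ha, r_val hi _ hb, ← hd]
      grind
    · rw [mul_c, s_c hjn, r_c hi _ ha, r_c hi _ hb]
      grind
  by_cases c2 : 0 < j ∧ d = j
  · left
    refine ⟨if a ≤ i then a + 1 else a - 1, ?_, ?_, ?_⟩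
    · split_ifs at * <;> omega
    · split_ifs at * <;> omega
    have hb : (if a ≤ i then a + 1 else a - 1) < 2 * (i + 1) := by split_ifs at * <;> omega
    apply ext_val <;> intro p
    · rw [mul_σ, Equiv.Perm.mul_apply, s_val hjn, r_val hi _ ha, r_val hi _ hb, ← hd]
      grind
    · rw [mul_c, s_c hjn, r_c hi _ ha, r_c hi _ hb]
      grind
  by_cases c3 : j = 0 ∧ d = 0
  · left
    refine ⟨if a ≤ i then a + 1 else a - 1, ?_, ?_, ?_⟩
    · split_ifs at * <;> omega
    · split_ifs at * <;> omega
    have hb : (if a ≤ i then a + 1 else a - 1) < 2 * (i + 1) := by split_ifs at * <;> omega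
    have h2 : (1 : ZMod 2) + 1 = 0 := rfl
    apply ext_val <;> intro p
    · rw [mul_σ, Equiv.Perm.mul_apply, s_val hjn, r_val hi _ ha, r_val hi _ hb, ← hd]
      grind
    · rw [mul_c, s_c hjn, r_c hi _ ha, r_c hi _ hb, r_val hi _ ha, ← hd]
      grind
  right
  have hdi : d ≤ i := by split_ifs at * <;> omega
  by_cases hdj : d < j
  · refine ⟨j - 1, by omega, ?_⟩
    have hb : j - 1 < n := by omega
    apply ext_val <;> intro p
    · simp only [mul_σ, Equiv.Perm.mul_apply, s_val hjn, r_val hi _ ha, s_val hb, ← hd]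
      clear hd ha
      split_ifs <;> omega
    · simp only [mul_c, s_c hjn, r_c hi _ ha, r_val hi _ ha, s_c hb, s_val hb, ← hd]
      clear hd ha
      grind
  · refine ⟨j, by omega, ?_⟩
    apply ext_val <;> intro p
    · simp only [mul_σ, Equiv.Perm.mul_apply, s_val hjn, r_val hi _ ha, ← hd]
      clear hd ha
      split_ifs <;> omega
    · simp only [mul_c, s_c hjn, s_val hjn, r_c hi _ ha, r_val hi _ ha, ← hd]
      clear hd ha
      grind

lemma s_mul_P (l : ℕ) (hl : l ≤ n) (j : ℕ) (hj : j < l) (k : ℕ → ℕ)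
    (hk : ∀ i, k i < 2 * (i + 1)) :
    ∃ k' : ℕ → ℕ, (∀ i, k' i < 2 * (i + 1)) ∧
      ∑ i ∈ range l, k' i ≤ ∑ i ∈ range l, k i + 1 ∧
      s j * P (fun i => (r i (k i) : GenPerm 2 n)) l = P (fun i => r i (k' i)) l := by
  induction l generalizing j with
  | zero => omega
  | succ l ih =>
    rcases s_mul_r (n := n) (i := l) (j := j) (by omega) (by omega) (k l) (hk l) with
      ⟨a, ha, hle, he⟩ | ⟨j', hj', he⟩
    · refine ⟨Function.update k l a, ?_, ?_, ?_⟩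
      · intro i
        by_cases h : i = l
        · subst h; simpa using ha
        · simpa [h] using hk i
      · rw [Finset.sum_range_succ, Finset.sum_range_succ]
        have : ∑ i ∈ range l, Function.update k l a i = ∑ i ∈ range l, k i := by
          apply Finset.sum_congr rfl
          intro i hi
          rw [Function.update_of_ne]
          have := Finset.mem_range.mp hi
          omega
        rw [this, Function.update_self]
        omega
      · rw [P, P, ← mul_assoc, he, Function.update_self]
        congr 1
        apply P_congr
        intro i hi
        rw [Function.update_of_ne (by omega)]
    · obtain ⟨k', hb, hs, hp⟩ := ih (by omega) j' hj'
      refine ⟨Function.update k' l (k l), ?_, ?_, ?_⟩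
      · intro i
        by_cases h : i = l
        · subst h; simpa using hk i
        · simpa [h] using hb i
      · rw [Finset.sum_range_succ, Finset.sum_range_succ]
        have : ∑ i ∈ range l, Function.update k' l (k l) i = ∑ i ∈ range l, k' i := by
          apply Finset.sum_congr rfl
          intro i hi
          rw [Function.update_of_ne]
          have := Finset.mem_range.mp hi
          omega
        rw [this, Function.update_self]
        omega
      · rw [P, P, ← mul_assoc, he, Function.update_self, mul_assoc, hp]
        congr 1
        apply P_congr
        intro i hi
        rw [Function.update_of_ne (by omega)]

lemma word_P (w : List (Fin n)) :
    ∃ k' : ℕ → ℕ, (∀ i, k' i < 2 * (i + 1)) ∧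
      ∑ i ∈ range n, k' i ≤ w.length ∧
      (w.map (fun i : Fin n => (s (i : ℕ) : GenPerm 2 n))).prod = P (fun i => r i (k' i)) n := by
  induction w with
  | nil =>
    refine ⟨fun _ => 0, fun i => by simp, by simp, ?_⟩
    have : ∀ l, P (fun i => (r i 0 : GenPerm 2 n)) l = 1 := by
      intro l
      induction l with
      | zero => rfl
      | succ l ih => rw [P, ih]; simp [r]
    rw [this]; simp
  | cons j w ih =>
    obtain ⟨k, hk, hs, he⟩ := ih
    obtain ⟨k', hk', hs', he'⟩ := s_mul_P n le_rfl j j.2 k hk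
    refine ⟨k', hk', ?_, ?_⟩
    · simp only [List.length_cons]; omega
    · rw [List.map_cons, List.prod_cons, he, he']

lemma len_P (k : K n) :
    len (P (fun i => (r i (ex k i) : GenPerm 2 n)) n) = ∑ i, (k i : ℕ) := by
  have hsum : ∑ i, (k i : ℕ) = ∑ i ∈ range n, ex k i := by
    rw [← Fin.sum_univ_eq_sum_range]
    simp [ex_fin]
  rw [hsum]
  have hw := isWord_P (m := 2) (n := n) (ex k) (ex_lt k) n le_rfl
  rw [len_eq]
  apply le_antisymm
  · exact Nat.sInf_le hw
  · refine le_csInf (s := {l | IsWord _ l}) ⟨_, hw⟩ ?_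
    rintro l ⟨w, rfl, hp⟩
    obtain ⟨k', hk', hs, he⟩ := word_P w
    have e : k = fun i => ⟨k' i, hk' i⟩ := by
      apply r_bij.1
      change P _ n = P _ n
      rw [← hp, he]
      apply P_congr
      intro i hi
      simp [ex, hi]
    refine le_trans (le_of_eq ?_) hs
    rw [← hsum, e, ← Fin.sum_univ_eq_sum_range]

/-- in the hyperoctahedral group `B_n = C_2 ≀ S_n`, the flag major
index is equidistributed with the Coxeter length. -/
theorem flagMajor_equidistributed_with_length (n k : ℕ) :
    Nat.card {π : GenPerm 2 n // flagMajor π = k} =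
      Nat.card {π : GenPerm 2 n // len π = k} := by
  have h1 : Nat.card {κ : K n // ∑ i, (κ i : ℕ) = k} =
      Nat.card {π : GenPerm 2 n // flagMajor π = k} :=
    Nat.card_congr ((Equiv.ofBijective _ t_bij).subtypeEquiv
      (fun κ => by rw [Equiv.ofBijective_apply, flagMajor_P]))
  have h2 : Nat.card {κ : K n // ∑ i, (κ i : ℕ) = k} =
      Nat.card {π : GenPerm 2 n // len π = k} :=
    Nat.card_congr ((Equiv.ofBijective _ r_bij).subtypeEquiv
      (fun κ => by rw [Equiv.ofBijective_apply, len_P]))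
  rw [← h1, h2]

end GenPerm
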